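/- arXiv:2104.03529 — 8 statements merged into one kernel-verified Lean document; each statement's English description precedes it below -/
import Mathlib

section
/- Let d ∈ {1, 2, 3}, ν > 0, r > 0 and r' ≥ 0 with r' + 1 = r·d/2. Let λ : ℕ → ℝ and t : ℕ → ℝ be sequences with λ(n) > 0, t(n) > 0 for n ≥ 1, λ(n) = Θ(n^{r}) and t(n) = Θ(n^{r'}) as n → ∞. For i = 1, 2 let A_i > 0, α_i > 0 and define ρ_i(n) = A_i·(2να_i² + λ(n))^{−ν−d/2}. Then the series Σ_n t(n)·((ρ₂(n) − ρ₁(n))/ρ₁(n))² converges if and only if A₁ = A₂. -/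
/-- `f(n) = Θ(n^s)` as `n → ∞`: there exist constants `0 < c ≤ C` with
`c·n^s ≤ f(n) ≤ C·n^s` for all sufficiently large `n`. -/
def IsBigTheta (f g : ℕ → ℝ) : Prop :=
  ∃ c C : ℝ, 0 < c ∧ c ≤ C ∧ ∃ N : ℕ, ∀ n ≥ N, c * g n ≤ f n ∧ f n ≤ C * g n

/-- The Matérn spectral density `ρ(n) = A·(2να² + λ(n))^{−ν−d/2}` on a compact
`d`-dimensional Riemannian manifold with Laplace–Beltrami eigenvalues `λ(n)`. -/
noncomputable def maternSpec (A α ν : ℝ) (d : ℕ) (lam : ℕ → ℝ) (n : ℕ) : ℝ :=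
  A * (2 * ν * α ^ 2 + lam n) ^ (-(ν + (d : ℝ) / 2))

open Filter Topology Asymptotics

theorem IsBigTheta.isTheta {f g : ℕ → ℝ} (h : IsBigTheta f g) (hg : ∀ n, 0 ≤ g n) :
    f =Θ[atTop] g := by
  obtain ⟨c, C, hc, hcC, N, hN⟩ := h
  constructor
  · refine IsBigO.of_bound C ?_
    filter_upwards [eventually_ge_atTop N] with n hn
    have h0 : 0 ≤ f n := (mul_nonneg hc.le (hg n)).trans (hN n hn).1
    rw [Real.norm_of_nonneg h0, Real.norm_of_nonneg (hg n)]
    exact (hN n hn).2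
  · refine IsBigO.of_bound c⁻¹ ?_
    filter_upwards [eventually_ge_atTop N] with n hn
    have h0 : 0 ≤ f n := (mul_nonneg hc.le (hg n)).trans (hN n hn).1
    rw [Real.norm_of_nonneg h0, Real.norm_of_nonneg (hg n), inv_mul_eq_div, le_div_iff₀' hc]
    exact (hN n hn).1

theorem maternSpec_relative_diff {A₁ A₂ α₁ α₂ ν : ℝ} (d : ℕ) {lam : ℕ → ℝ} {n : ℕ}
    (hν : 0 < ν) (hA₁ : 0 < A₁) (hlam : 0 < lam n) :
    (maternSpec A₂ α₂ ν d lam n - maternSpec A₁ α₁ ν d lam n) / maternSpec A₁ α₁ ν d lam n =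
      A₂ / A₁ * (1 + (2 * ν * α₂ ^ 2 - 2 * ν * α₁ ^ 2) / (2 * ν * α₁ ^ 2 + lam n)) ^
        (-(ν + (d : ℝ) / 2)) - 1 := by
  have h1 : 0 < 2 * ν * α₁ ^ 2 + lam n := by positivity
  have h2 : 0 < 2 * ν * α₂ ^ 2 + lam n := by positivity
  have hu : 1 + (2 * ν * α₂ ^ 2 - 2 * ν * α₁ ^ 2) / (2 * ν * α₁ ^ 2 + lam n) =
      (2 * ν * α₂ ^ 2 + lam n) / (2 * ν * α₁ ^ 2 + lam n) := by
    field_simp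
    ring
  have h3 := Real.rpow_pos_of_pos h1 (-(ν + (d : ℝ) / 2))
  rw [hu, Real.div_rpow h2.le h1.le]
  unfold maternSpec
  field_simp

theorem isBigO_one_add_rpow_sub_one (p : ℝ) :
    (fun x : ℝ => (1 + x) ^ p - 1) =O[𝓝 0] fun x => x := by
  have h : HasDerivAt (fun x : ℝ => (1 + x) ^ p) (1 * p * (1 + 0) ^ (p - 1)) 0 :=
    ((hasDerivAt_id (0 : ℝ)).const_add 1).rpow_const (Or.inl (by norm_num))
  simpa using h.differentiableAt.isBigO_sub

/-- Let `d ∈ {1,2,3}`, `ν > 0`, `r > 0` and `r' ≥ 0` with `r' + 1 = r·d/2`.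
Let `λ t : ℕ → ℝ` be sequences with `λ(n) > 0`, `t(n) > 0` for `n ≥ 1`, `λ(n) = Θ(n^r)`
and `t(n) = Θ(n^{r'})`. For `i = 1,2` let `A_i > 0`, `α_i > 0` and define
`ρ_i(n) = A_i·(2να_i² + λ(n))^{−ν−d/2}`. Then `Σ_n t(n)·((ρ₂(n) − ρ₁(n))/ρ₁(n))²`
converges if and only if `A₁ = A₂`. -/
theorem stmt_5 (d : ℕ) (hd : d = 1 ∨ d = 2 ∨ d = 3) (ν r r' : ℝ)
    (hν : 0 < ν) (hr : 0 < r) (hr' : 0 ≤ r') (hrel : r' + 1 = r * d / 2)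
    (lam t : ℕ → ℝ) (hlam : ∀ n ≥ 1, 0 < lam n) (ht : ∀ n ≥ 1, 0 < t n)
    (hΘlam : IsBigTheta lam (fun n => (n : ℝ) ^ r))
    (hΘt : IsBigTheta t (fun n => (n : ℝ) ^ r'))
    (A₁ A₂ α₁ α₂ : ℝ) (hA₁ : 0 < A₁) (hA₂ : 0 < A₂) (hα₁ : 0 < α₁) (hα₂ : 0 < α₂) :
    (Summable fun n : ℕ => t (n + 1) *
        ((maternSpec A₂ α₂ ν d lam (n + 1) - maternSpec A₁ α₁ ν d lam (n + 1)) /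
          maternSpec A₁ α₁ ν d lam (n + 1)) ^ 2) ↔ A₁ = A₂ := by
  set p : ℝ := -(ν + (d : ℝ) / 2) with hp
  set b : ℝ := 2 * ν * α₁ ^ 2 with hb
  set u : ℕ → ℝ := fun n => (2 * ν * α₂ ^ 2 - b) / (b + lam n) with hu
  have hb0 : 0 < b := by positivity
  have hlamΘ := hΘlam.isTheta fun n => by positivity
  have htΘ := hΘt.isTheta fun n => by positivity
  have hpow : Tendsto (fun n : ℕ => (n : ℝ) ^ (-r)) atTop (𝓝 0) :=
    (tendsto_rpow_neg_atTop hr).comp tendsto_natCast_atTop_atTop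
  have huO : u =O[atTop] fun n : ℕ => (n : ℝ) ^ (-r) := by
    have hinv : (fun n => (b + lam n)⁻¹) =O[atTop] fun n => (lam n)⁻¹ := by
      refine IsBigO.of_bound 1 ?_
      filter_upwards [eventually_ge_atTop 1] with n hn
      have := hlam n hn
      rw [Real.norm_of_nonneg (by positivity), Real.norm_of_nonneg (by positivity), one_mul]
      gcongr
      linarith
    have hlaminv : (fun n => (lam n)⁻¹) =O[atTop] fun n : ℕ => (n : ℝ) ^ (-r) := by
      simpa only [Real.rpow_neg (Nat.cast_nonneg _)] using hlamΘ.inv.isBigO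
    exact (hinv.trans hlaminv).const_mul_left _
  have hu0 : Tendsto u atTop (𝓝 0) := huO.trans_tendsto hpow
  have hqO : (fun n => (1 + u n) ^ p - 1) =O[atTop] fun n : ℕ => (n : ℝ) ^ (-r) :=
    ((isBigO_one_add_rpow_sub_one p).comp_tendsto hu0).trans huO
  rw [summable_nat_add_iff (f := fun n : ℕ => t n *
    ((maternSpec A₂ α₂ ν d lam n - maternSpec A₁ α₁ ν d lam n) /
      maternSpec A₁ α₁ ν d lam n) ^ 2) 1]
  have heq : (fun n : ℕ => t n * ((maternSpec A₂ α₂ ν d lam n - maternSpec A₁ α₁ ν d lam n) /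
      maternSpec A₁ α₁ ν d lam n) ^ 2) =ᶠ[atTop]
      fun n => t n * (A₂ / A₁ * (1 + u n) ^ p - 1) ^ 2 := by
    filter_upwards [eventually_ge_atTop 1] with n hn
    rw [maternSpec_relative_diff d hν hA₁ (hlam n hn)]
  constructor
  · intro hs
    have hterm := hs.tendsto_atTop_zero.congr' heq
    have hone : (fun _ : ℕ => (1 : ℝ)) =O[atTop] t := by
      refine IsBigO.trans ?_ htΘ.symm.isBigO
      refine IsBigO.of_bound 1 ?_
      filter_upwards [eventually_ge_atTop 1] with n hn
      rw [norm_one, one_mul, Real.norm_of_nonneg (by positivity)]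
      exact Real.one_le_rpow (by exact_mod_cast hn) hr'
    have hsq : Tendsto (fun n => (A₂ / A₁ * (1 + u n) ^ p - 1) ^ 2) atTop (𝓝 0) := by
      have := hone.mul (isBigO_refl (fun n => (A₂ / A₁ * (1 + u n) ^ p - 1) ^ 2) atTop)
      simpa only [one_mul] using this.trans_tendsto hterm
    have hlim : Tendsto (fun n => (A₂ / A₁ * (1 + u n) ^ p - 1) ^ 2) atTop
        (𝓝 ((A₂ / A₁ * 1 - 1) ^ 2)) := by
      have hq : Tendsto (fun n => (1 + u n) ^ p) atTop (𝓝 1) := by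
        simpa using (hqO.trans_tendsto hpow).add_const 1
      exact ((hq.const_mul _).sub_const 1).pow 2
    have h0 := pow_eq_zero_iff two_ne_zero |>.1 (tendsto_nhds_unique hlim hsq)
    rw [mul_one, sub_eq_zero, div_eq_one_iff_eq hA₁.ne'] at h0
    exact h0.symm
  · rintro rfl
    have hexp : r' - 2 * r < -1 := by
      rcases hd with rfl | rfl | rfl <;> push_cast at hrel <;> linarith
    refine summable_of_isBigO_nat (Real.summable_nat_rpow.2 hexp) (heq.trans_isBigO ?_)
    simp only [div_self hA₁.ne', one_mul]
    refine (htΘ.isBigO.mul (hqO.pow 2)).congr' EventuallyEq.rfl ?_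
    filter_upwards [eventually_ge_atTop 1] with n hn
    have hn0 : (0 : ℝ) < n := by exact_mod_cast hn
    rw [← Real.rpow_natCast, ← Real.rpow_mul hn0.le, ← Real.rpow_add hn0]
    congr 1
    push_cast
    ring
end

section
/- Let d ≥ 4 be an integer, ν > 0, r > 0 and r' ≥ 0 with r' + 1 = r·d/2. Let λ : ℕ → ℝ and t : ℕ → ℝ be sequences with λ(n) > 0, t(n) > 0 for n ≥ 1, λ(n) = Θ(n^{r}) and t(n) = Θ(n^{r'}) as n → ∞. For i = 1, 2 let A_i > 0, α_i > 0 and define ρ_i(n) = A_i·(2να_i² + λ(n))^{−ν−d/2}. Then the series Σ_n t(n)·((ρ₂(n) − ρ₁(n))/ρ₁(n))² converges if and only if A₁ = A₂ and α₁ = α₂. -/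
open Filter Topology

theorem tendsto_add_div_add_atTop (a b : ℝ) :
    Tendsto (fun x : ℝ => (a + x) / (b + x)) atTop (𝓝 1) := by
  have h : Tendsto (fun x : ℝ => 1 + (a - b) / (b + x)) atTop (𝓝 (1 + 0)) :=
    tendsto_const_nhds.add
      (tendsto_const_nhds.div_atTop (tendsto_atTop_add_const_left _ b tendsto_id))
  rw [add_zero] at h
  refine h.congr' ?_
  filter_upwards [eventually_gt_atTop (-b)] with x hx
  have : b + x ≠ 0 := by linarith
  field_simp
  ring

/-- First-order expansion of `((a + x) / (b + x)) ^ p` at infinity. -/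
theorem tendsto_mul_add_div_add_rpow_sub_one (a b p : ℝ) (hab : a ≠ b) :
    Tendsto (fun x : ℝ => x * (((a + x) / (b + x)) ^ p - 1)) atTop (𝓝 (p * (a - b))) := by
  have hd : HasDerivAt (fun u : ℝ => u ^ p) p 1 := by
    simpa using Real.hasDerivAt_rpow_const (x := 1) (p := p) (Or.inl one_ne_zero)
  have hu : Tendsto (fun x : ℝ => (a + x) / (b + x)) atTop (𝓝[≠] 1) := by
    refine tendsto_nhdsWithin_iff.2 ⟨tendsto_add_div_add_atTop a b, ?_⟩
    filter_upwards [eventually_gt_atTop (-b)] with x hx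
    have hbx : b + x ≠ 0 := by linarith
    simpa [div_eq_one_iff_eq hbx] using hab
  have hx : Tendsto (fun x : ℝ => (a - b) * ((0 + x) / (b + x))) atTop (𝓝 ((a - b) * 1)) :=
    (tendsto_add_div_add_atTop 0 b).const_mul _
  have h := ((hasDerivAt_iff_tendsto_slope.1 hd).comp hu).mul hx
  rw [mul_one] at h
  refine h.congr' ?_
  filter_upwards [eventually_gt_atTop (-b)] with x hx
  have hbx : b + x ≠ 0 := by linarith
  have hne : a - b ≠ 0 := sub_ne_zero.2 hab
  have hsub : (a + x) / (b + x) - 1 = (a - b) / (b + x) := by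
    field_simp
    ring
  simp only [Function.comp, slope_def_field, Real.one_rpow, hsub]
  field_simp
  ring

theorem IsBigTheta.tendsto_atTop {f g : ℕ → ℝ} (h : IsBigTheta f g) (hg : Tendsto g atTop atTop) :
    Tendsto f atTop atTop := by
  obtain ⟨c, C, hc, -, N, hN⟩ := h
  refine tendsto_atTop_mono' _ ?_ (hg.const_mul_atTop hc)
  filter_upwards [eventually_ge_atTop N] with n hn using (hN n hn).1

theorem maternSpec_relative_difference {A₁ A₂ α₁ α₂ ν : ℝ} {d : ℕ} {lam : ℕ → ℝ} {n : ℕ}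
    (hA₁ : 0 < A₁) (hα₁ : 0 < α₁) (hα₂ : 0 < α₂) (hν : 0 < ν) (hn : 0 < lam n) :
    (maternSpec A₂ α₂ ν d lam n - maternSpec A₁ α₁ ν d lam n) / maternSpec A₁ α₁ ν d lam n =
      A₂ / A₁ * ((2 * ν * α₁ ^ 2 + lam n) / (2 * ν * α₂ ^ 2 + lam n)) ^ (ν + (d : ℝ) / 2) - 1 := by
  have h₁ : 0 < 2 * ν * α₁ ^ 2 + lam n := by positivity
  have h₂ : 0 < 2 * ν * α₂ ^ 2 + lam n := by positivity
  have h₃ := Real.rpow_pos_of_pos h₁ (ν + (d : ℝ) / 2)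
  have h₄ := Real.rpow_pos_of_pos h₂ (ν + (d : ℝ) / 2)
  unfold maternSpec
  rw [Real.rpow_neg h₁.le, Real.rpow_neg h₂.le, Real.div_rpow h₁.le h₂.le]
  field_simp

/-- If `t(n) = Θ(n ^ r')` with `r' ≥ 0` and `Σ t(n) q(n)²` converges, then `q(n) → 0`. -/
theorem tendsto_zero_of_summable_mul_sq {t q : ℕ → ℝ} {r' : ℝ} (hr' : 0 ≤ r')
    (ht : IsBigTheta t (fun n => (n : ℝ) ^ r')) (hs : Summable fun n => t n * q n ^ 2) :
    Tendsto q atTop (𝓝 0) := by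
  obtain ⟨c, C, hc, -, N, hN⟩ := ht
  have hsq : Tendsto (fun n => q n ^ 2) atTop (𝓝 0) := by
    have h0 := hs.tendsto_atTop_zero.const_mul c⁻¹
    rw [mul_zero] at h0
    refine squeeze_zero' (Eventually.of_forall fun n => sq_nonneg _) ?_ h0
    filter_upwards [eventually_ge_atTop N, eventually_ge_atTop 1] with n hn hn1
    have h1 : (1 : ℝ) ≤ (n : ℝ) ^ r' := Real.one_le_rpow (by exact_mod_cast hn1) hr'
    have h2 : c ≤ t n := by nlinarith [(hN n hn).1]
    rw [← mul_assoc, inv_mul_eq_div]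
    exact le_mul_of_one_le_left (sq_nonneg _) ((one_le_div hc).2 h2)
  have := hsq.sqrt
  simp only [Real.sqrt_sq_eq_abs, Real.sqrt_zero] at this
  exact (tendsto_zero_iff_abs_tendsto_zero _).2 this

/-- If `q(n)` decays exactly like `1 / lam(n)`, then `Σ t(n) q(n)²` diverges as soon as
`t(n) / lam(n)²` dominates `1 / n`. -/
theorem not_summable_mul_sq {t lam q : ℕ → ℝ} {r r' L : ℝ} (hL : L ≠ 0) (hrr' : 2 * r ≤ r' + 1)
    (ht : IsBigTheta t (fun n => (n : ℝ) ^ r')) (hlam : IsBigTheta lam (fun n => (n : ℝ) ^ r))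
    (hq : Tendsto (fun n => lam n * q n) atTop (𝓝 L)) : ¬ Summable fun n => t n * q n ^ 2 := by
  intro hs
  obtain ⟨c, _, hc, -, N, hN⟩ := ht
  obtain ⟨c', C, hc', hC, M, hM⟩ := hlam
  have hC0 : 0 < C := hc'.trans_le hC
  have hLpos : 0 < L ^ 2 := by positivity
  have hev := (hq.pow 2).eventually (lt_mem_nhds (half_lt_self hLpos))
  refine Real.not_summable_natCast_inv
    (summable_of_isBigO_nat hs (Asymptotics.IsBigO.of_bound (C ^ 2 / (c * (L ^ 2 / 2))) ?_))
  filter_upwards [hev, eventually_ge_atTop N, eventually_ge_atTop M, eventually_ge_atTop 1]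
    with n hn hnN hnM hn1
  have hn0 : (0 : ℝ) < n := by exact_mod_cast hn1
  have hs0 : 0 < (n : ℝ) ^ r := Real.rpow_pos_of_pos hn0 r
  have hs1 : 0 < (n : ℝ) ^ r' := Real.rpow_pos_of_pos hn0 r'
  have hl0 : 0 < lam n := (mul_pos hc' hs0).trans_le (hM n hnM).1
  have hpow : ((n : ℝ) ^ r) ^ 2 ≤ (n : ℝ) ^ r' * n := by
    rw [← Real.rpow_natCast, ← Real.rpow_mul hn0.le, ← Real.rpow_add_one hn0.ne']
    exact Real.rpow_le_rpow_of_exponent_le (by exact_mod_cast hn1) (by push_cast; linarith)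
  have hlq : L ^ 2 / 2 ≤ C ^ 2 * ((n : ℝ) ^ r' * n) * q n ^ 2 := by
    calc L ^ 2 / 2 ≤ lam n ^ 2 * q n ^ 2 := by rw [← mul_pow]; exact hn.le
      _ ≤ (C * (n : ℝ) ^ r) ^ 2 * q n ^ 2 := by gcongr; exact (hM n hnM).2
      _ ≤ C ^ 2 * ((n : ℝ) ^ r' * n) * q n ^ 2 := by rw [mul_pow]; gcongr
  have htn : c * (n : ℝ) ^ r' ≤ t n := (hN n hnN).1
  have ht0 : 0 ≤ t n := (mul_pos hc hs1).le.trans htn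
  rw [Real.norm_of_nonneg (by positivity), Real.norm_of_nonneg (by positivity),
    div_mul_eq_mul_div, inv_eq_one_div, div_le_div_iff₀ hn0 (by positivity), one_mul]
  calc c * (L ^ 2 / 2) ≤ c * (C ^ 2 * ((n : ℝ) ^ r' * n) * q n ^ 2) := by gcongr
    _ = C ^ 2 * (c * (n : ℝ) ^ r' * q n ^ 2) * n := by ring
    _ ≤ C ^ 2 * (t n * q n ^ 2) * n := by gcongr

/-- Let `d ≥ 4` be an integer, `ν > 0`, `r > 0` and `r' ≥ 0` with
`r' + 1 = r·d/2`. Let `λ t : ℕ → ℝ` be sequences with `λ(n) > 0`, `t(n) > 0` for `n ≥ 1`,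
`λ(n) = Θ(n^r)` and `t(n) = Θ(n^{r'})`. For `i = 1,2` let `A_i > 0`, `α_i > 0` and define
`ρ_i(n) = A_i·(2να_i² + λ(n))^{−ν−d/2}`. Then `Σ_n t(n)·((ρ₂(n) − ρ₁(n))/ρ₁(n))²`
converges if and only if `A₁ = A₂` and `α₁ = α₂`. -/
theorem stmt_6 (d : ℕ) (hd : 4 ≤ d) (ν r r' : ℝ)
    (hν : 0 < ν) (hr : 0 < r) (hr' : 0 ≤ r') (hrel : r' + 1 = r * d / 2)
    (lam t : ℕ → ℝ) (hlam : ∀ n ≥ 1, 0 < lam n) (ht : ∀ n ≥ 1, 0 < t n)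
    (hΘlam : IsBigTheta lam (fun n => (n : ℝ) ^ r))
    (hΘt : IsBigTheta t (fun n => (n : ℝ) ^ r'))
    (A₁ A₂ α₁ α₂ : ℝ) (hA₁ : 0 < A₁) (hA₂ : 0 < A₂) (hα₁ : 0 < α₁) (hα₂ : 0 < α₂) :
    (Summable fun n : ℕ => t (n + 1) *
        ((maternSpec A₂ α₂ ν d lam (n + 1) - maternSpec A₁ α₁ ν d lam (n + 1)) /
          maternSpec A₁ α₁ ν d lam (n + 1)) ^ 2) ↔ (A₁ = A₂ ∧ α₁ = α₂) := by
  constructor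
  · intro hs
    rw [summable_nat_add_iff (f := fun n => t n *
      ((maternSpec A₂ α₂ ν d lam n - maternSpec A₁ α₁ ν d lam n) /
        maternSpec A₁ α₁ ν d lam n) ^ 2) 1] at hs
    have hlim : Tendsto lam atTop atTop :=
      hΘlam.tendsto_atTop ((tendsto_rpow_atTop hr).comp tendsto_natCast_atTop_atTop)
    have hratio : (fun n => A₂ / A₁ * ((2 * ν * α₁ ^ 2 + lam n) / (2 * ν * α₂ ^ 2 + lam n)) ^
        (ν + (d : ℝ) / 2) - 1) =ᶠ[atTop] fun n =>
        (maternSpec A₂ α₂ ν d lam n - maternSpec A₁ α₁ ν d lam n) /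
          maternSpec A₁ α₁ ν d lam n := by
      filter_upwards [eventually_ge_atTop 1] with n hn
      exact (maternSpec_relative_difference hA₁ hα₁ hα₂ hν (hlam n hn)).symm
    have hA : A₁ = A₂ := by
      have h := ((((tendsto_add_div_add_atTop (2 * ν * α₁ ^ 2) (2 * ν * α₂ ^ 2)).comp
        hlim).rpow_const (p := ν + (d : ℝ) / 2) (Or.inl one_ne_zero)).const_mul
        (A₂ / A₁)).sub_const 1
      have h0 := tendsto_nhds_unique (h.congr' hratio)
        (tendsto_zero_of_summable_mul_sq hr' hΘt hs)
      rw [Real.one_rpow, mul_one, sub_eq_zero, div_eq_one_iff_eq hA₁.ne'] at h0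
      exact h0.symm
    refine ⟨hA, ?_⟩
    by_contra hα
    have hb : 2 * ν * α₁ ^ 2 ≠ 2 * ν * α₂ ^ 2 := by
      intro h
      have h2 : α₁ ^ 2 = α₂ ^ 2 := mul_left_cancel₀ (by positivity) h
      exact hα ((pow_left_inj₀ hα₁.le hα₂.le two_ne_zero).1 h2)
    have hd' : (4 : ℝ) ≤ d := by exact_mod_cast hd
    have hL : (ν + (d : ℝ) / 2) * (2 * ν * α₁ ^ 2 - 2 * ν * α₂ ^ 2) ≠ 0 :=
      mul_ne_zero (by positivity) (sub_ne_zero.2 hb)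
    refine not_summable_mul_sq hL (r := r) (r' := r') (by nlinarith) hΘt hΘlam ?_ hs
    refine ((tendsto_mul_add_div_add_rpow_sub_one _ _ (ν + (d : ℝ) / 2) hb).comp hlim).congr' ?_
    filter_upwards [hratio] with n hn
    rw [← hn, ← hA, div_self hA₁.ne', one_mul]
    rfl
  · rintro ⟨rfl, rfl⟩
    simp
end

section
/- Let λ : ℕ → ℝ and t : ℕ → ℝ be sequences with λ(n) > 0 and t(n) ≥ 0 for all n ≥ 1, λ(n) → ∞ as n → ∞, and Σ_n t(n)/λ(n)² < ∞. Let ν > 0, d ≥ 1, A > 0 and α₁, α₂ > 0, and define ρ_i(n) = A·(2να_i² + λ(n))^{−ν−d/2} for i = 1, 2. Then the series Σ_n t(n)·((ρ₂(n) − ρ₁(n))/ρ₁(n))² converges. -/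
open Filter Asymptotics Topology in
theorem isBigO_shift_div_rpow_sub_one {a : ℝ} (ha : 0 < a) (b r : ℝ) :
    (fun x : ℝ => ((b + x) / (a + x)) ^ r - 1) =O[atTop] fun x => x⁻¹ := by
  have hO : (fun x : ℝ => (b + x) / (a + x) - 1) =O[atTop] fun x => x⁻¹ := by
    refine IsBigO.of_bound |b - a| ?_
    filter_upwards [eventually_gt_atTop 0] with x hx
    have hax : 0 < a + x := by positivity
    have h : (b + x) / (a + x) - 1 = (b - a) * (a + x)⁻¹ := by
      field_simp
      ring
    rw [h, norm_mul, Real.norm_eq_abs, norm_inv, norm_inv, Real.norm_of_nonneg hax.le,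
      Real.norm_of_nonneg hx.le]
    gcongr
    linarith
  have hlim : Tendsto (fun x : ℝ => (b + x) / (a + x)) atTop (𝓝 1) :=
    tendsto_sub_nhds_zero_iff.1 (hO.trans_tendsto tendsto_inv_atTop_zero)
  have hd : (fun y : ℝ => y ^ r - 1) =O[𝓝 1] fun y => y - 1 := by
    simpa using (Real.hasDerivAt_rpow_const (x := 1) (p := r) (Or.inl one_ne_zero)).isBigO_sub
  exact (hd.comp_tendsto hlim).trans hO

theorem maternSpec_sub_div {A α₁ α₂ ν : ℝ} (hA : A ≠ 0) (hν : 0 < ν) (d : ℕ) {lam : ℕ → ℝ}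
    {n : ℕ} (hn : 0 < lam n) :
    (maternSpec A α₂ ν d lam n - maternSpec A α₁ ν d lam n) / maternSpec A α₁ ν d lam n =
      ((2 * ν * α₂ ^ 2 + lam n) / (2 * ν * α₁ ^ 2 + lam n)) ^ (-(ν + (d : ℝ) / 2)) - 1 := by
  have h₁ : 0 < 2 * ν * α₁ ^ 2 + lam n := by positivity
  have h₂ : 0 < 2 * ν * α₂ ^ 2 + lam n := by positivity
  have hp := (Real.rpow_pos_of_pos h₁ (-(ν + (d : ℝ) / 2))).ne'
  unfold maternSpec
  rw [Real.div_rpow h₂.le h₁.le, sub_div, div_self (mul_ne_zero hA hp),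
    mul_div_mul_left _ _ hA]

/-- Let `λ t : ℕ → ℝ` be sequences with `λ(n) > 0` and `t(n) ≥ 0` for all
`n ≥ 1`, `λ(n) → ∞` as `n → ∞`, and `Σ_n t(n)/λ(n)² < ∞`. Let `ν > 0`, `d ≥ 1`, `A > 0`
and `α₁, α₂ > 0`, and define `ρ_i(n) = A·(2να_i² + λ(n))^{−ν−d/2}` for `i = 1,2`.
Then the series `Σ_n t(n)·((ρ₂(n) − ρ₁(n))/ρ₁(n))²` converges. -/
theorem stmt_8 (lam t : ℕ → ℝ) (hlam : ∀ n ≥ 1, 0 < lam n) (ht : ∀ n ≥ 1, 0 ≤ t n)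
    (hlim : Filter.Tendsto lam Filter.atTop Filter.atTop)
    (hsum : Summable fun n : ℕ => t (n + 1) / lam (n + 1) ^ 2)
    (ν : ℝ) (hν : 0 < ν) (d : ℕ) (hd : 1 ≤ d)
    (A α₁ α₂ : ℝ) (hA : 0 < A) (hα₁ : 0 < α₁) (hα₂ : 0 < α₂) :
    Summable fun n : ℕ => t (n + 1) *
      ((maternSpec A α₂ ν d lam (n + 1) - maternSpec A α₁ ν d lam (n + 1)) /
        maternSpec A α₁ ν d lam (n + 1)) ^ 2 := by
  refine summable_of_isBigO_nat hsum ?_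
  have hO := (isBigO_shift_div_rpow_sub_one (a := 2 * ν * α₁ ^ 2) (by positivity)
    (2 * ν * α₂ ^ 2) (-(ν + (d : ℝ) / 2))).comp_tendsto
      (hlim.comp (Filter.tendsto_add_atTop_nat 1))
  refine ((Asymptotics.isBigO_refl (fun n : ℕ => t (n + 1)) Filter.atTop).mul
    (hO.pow 2)).congr (fun n => ?_) (fun n => ?_)
  · rw [maternSpec_sub_div hA.ne' hν d (hlam (n + 1) (by omega))]
    rfl
  · simp [div_eq_mul_inv]
end

section
/- Let d ∈ {1, 2, 3} and ν > 0. Define λ(n) = n(n + d − 1), t_d(0) = 1 and t_d(n) = ((2n + d − 1)/n)·C(n + d − 2, n − 1) for n ≥ 1, where C(·,·) is the binomial coefficient. For i = 1, 2 let A_i > 0, α_i > 0 and define ρ_i(n) = A_i·(2να_i² + λ(n))^{−ν−d/2}. Then the series Σ_{n=0}^{∞} t_d(n)·((ρ₂(n) − ρ₁(n))/ρ₁(n))² converges if and only if A₁ = A₂. -/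
/-- The multiplicity `t_d(n)` of the `n`-th eigenvalue `n(n + d − 1)` of the negative
Laplace–Beltrami operator on the `d`-dimensional sphere `S^d`: `t_d(0) = 1` and
`t_d(n) = ((2n + d − 1)/n)·C(n + d − 2, n − 1)` for `n ≥ 1`. -/
noncomputable def sphMult (d n : ℕ) : ℝ :=
  if n = 0 then 1
  else (2 * (n : ℝ) + (d : ℝ) - 1) / (n : ℝ) * (Nat.choose (n + d - 2) (n - 1) : ℝ)

/-- The Matérn spectral density on the sphere `S^d`:
`ρ(n) = A·(2να² + n(n + d − 1))^{−ν−d/2}`. -/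
noncomputable def maternSphSpec (A α ν : ℝ) (d n : ℕ) : ℝ :=
  A * (2 * ν * α ^ 2 + (n : ℝ) * ((n : ℝ) + (d : ℝ) - 1)) ^ (-(ν + (d : ℝ) / 2))

open Filter Topology Asymptotics

lemma sphMult_bounds {d : ℕ} (hd : d = 1 ∨ d = 2 ∨ d = 3) (n : ℕ) :
    1 ≤ sphMult d n ∧ sphMult d n ≤ ((n : ℝ) + 1) ^ 2 + 1 := by
  rcases n with _ | n
  · norm_num [sphMult]
  have hn : (0 : ℝ) ≤ n := n.cast_nonneg
  rcases hd with rfl | rfl | rfl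
  · have h : sphMult 1 (n + 1) = 2 := by
      simp only [sphMult, Nat.succ_ne_zero, if_false, show n + 1 + 1 - 2 = n by omega,
        Nat.add_sub_cancel, Nat.choose_self]
      push_cast
      field_simp
      ring
    rw [h]
    push_cast
    constructor <;> nlinarith
  · have h : sphMult 2 (n + 1) = 2 * n + 3 := by
      simp only [sphMult, Nat.succ_ne_zero, if_false, show n + 1 + 2 - 2 = n + 1 by omega,
        Nat.add_sub_cancel, Nat.choose_succ_self_right]
      push_cast
      field_simp
      ring
    rw [h]
    push_cast
    constructor <;> nlinarith
  · have h : sphMult 3 (n + 1) = (n + 2) ^ 2 := by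
      have hc : (Nat.choose (n + 2) n : ℝ) = (n + 2) * (n + 1) / 2 := by
        rw [Nat.choose_symm_add, Nat.cast_choose_two]
        push_cast
        ring
      simp only [sphMult, Nat.succ_ne_zero, if_false, show n + 1 + 3 - 2 = n + 2 by omega,
        Nat.add_sub_cancel, hc]
      push_cast
      field_simp
      ring
    rw [h]
    push_cast
    constructor <;> nlinarith

lemma sphMult_isBigO {d : ℕ} (hd : d = 1 ∨ d = 2 ∨ d = 3) :
    (fun n : ℕ => sphMult d n) =O[atTop] fun n : ℕ => (n : ℝ) ^ 2 := by
  refine IsBigO.of_bound 5 ?_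
  filter_upwards [eventually_ge_atTop 1] with n hn
  obtain ⟨h1, h2⟩ := sphMult_bounds hd n
  have hn' : (1 : ℝ) ≤ n := by exact_mod_cast hn
  rw [Real.norm_of_nonneg (by linarith), Real.norm_of_nonneg (by positivity)]
  nlinarith

/-- The relative difference of two spectral densities, in terms of the quotient of the bases
of the powers. -/
lemma maternSphSpec_sub_div {d : ℕ} (hd : 1 ≤ d) {ν A₁ α₁ α₂ : ℝ} (hν : 0 < ν) (A₂ : ℝ)
    (hA₁ : 0 < A₁) (hα₁ : 0 < α₁) (hα₂ : 0 < α₂) (n : ℕ) :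
    (maternSphSpec A₂ α₂ ν d n - maternSphSpec A₁ α₁ ν d n) / maternSphSpec A₁ α₁ ν d n =
      A₂ / A₁ * ((2 * ν * α₂ ^ 2 + (n : ℝ) * ((n : ℝ) + (d : ℝ) - 1)) /
        (2 * ν * α₁ ^ 2 + (n : ℝ) * ((n : ℝ) + (d : ℝ) - 1))) ^ (-(ν + (d : ℝ) / 2)) - 1 := by
  have hd' : (1 : ℝ) ≤ d := by exact_mod_cast hd
  have hl : 0 ≤ (n : ℝ) * ((n : ℝ) + (d : ℝ) - 1) :=
    mul_nonneg n.cast_nonneg (by linarith [(n.cast_nonneg : (0 : ℝ) ≤ n)])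
  have h1 : 0 < 2 * ν * α₁ ^ 2 + (n : ℝ) * ((n : ℝ) + (d : ℝ) - 1) := by positivity
  have h2 : 0 < 2 * ν * α₂ ^ 2 + (n : ℝ) * ((n : ℝ) + (d : ℝ) - 1) := by positivity
  have h3 := Real.rpow_pos_of_pos h1 (-(ν + (d : ℝ) / 2))
  rw [maternSphSpec, maternSphSpec, Real.div_rpow h2.le h1.le, sub_div,
    div_self (mul_pos hA₁ h3).ne', mul_div_mul_comm]

lemma base_quotient_sub_one_isBigO {d : ℕ} (hd : 1 ≤ d) {c₁ : ℝ} (hc₁ : 0 < c₁) (c₂ : ℝ) :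
    (fun n : ℕ => (c₂ + (n : ℝ) * ((n : ℝ) + (d : ℝ) - 1)) /
      (c₁ + (n : ℝ) * ((n : ℝ) + (d : ℝ) - 1)) - 1) =O[atTop] fun n : ℕ => ((n : ℝ) ^ 2)⁻¹ := by
  refine IsBigO.of_bound |c₂ - c₁| ?_
  filter_upwards [eventually_ge_atTop 1] with n hn
  have hd' : (1 : ℝ) ≤ d := by exact_mod_cast hd
  have hn' : (1 : ℝ) ≤ n := by exact_mod_cast hn
  have hl : (n : ℝ) ^ 2 ≤ c₁ + (n : ℝ) * ((n : ℝ) + (d : ℝ) - 1) := by nlinarith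
  have h1 : 0 < c₁ + (n : ℝ) * ((n : ℝ) + (d : ℝ) - 1) := by nlinarith
  rw [div_sub_one h1.ne', add_sub_add_right_eq_sub, norm_div, Real.norm_eq_abs,
    Real.norm_of_nonneg h1.le, Real.norm_of_nonneg (by positivity), div_eq_mul_inv]
  gcongr

lemma tendsto_inv_natCast_sq : Tendsto (fun n : ℕ => ((n : ℝ) ^ 2)⁻¹) atTop (𝓝 0) :=
  ((tendsto_pow_atTop two_ne_zero).comp tendsto_natCast_atTop_atTop).inv_tendsto_atTop

lemma tendsto_base_quotient {d : ℕ} (hd : 1 ≤ d) {c₁ : ℝ} (hc₁ : 0 < c₁) (c₂ : ℝ) :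
    Tendsto (fun n : ℕ => (c₂ + (n : ℝ) * ((n : ℝ) + (d : ℝ) - 1)) /
      (c₁ + (n : ℝ) * ((n : ℝ) + (d : ℝ) - 1))) atTop (𝓝 1) := by
  simpa using
    ((base_quotient_sub_one_isBigO hd hc₁ c₂).trans_tendsto tendsto_inv_natCast_sq).add_const 1

/-- Let `d ∈ {1,2,3}` and `ν > 0`. Define `λ(n) = n(n + d − 1)`,
`t_d(0) = 1` and `t_d(n) = ((2n + d − 1)/n)·C(n + d − 2, n − 1)` for `n ≥ 1`. For
`i = 1,2` let `A_i > 0`, `α_i > 0` and define `ρ_i(n) = A_i·(2να_i² + λ(n))^{−ν−d/2}`.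
Then `Σ_{n=0}^∞ t_d(n)·((ρ₂(n) − ρ₁(n))/ρ₁(n))²` converges if and only if `A₁ = A₂`. -/
theorem stmt_10 (d : ℕ) (hd : d = 1 ∨ d = 2 ∨ d = 3) (ν : ℝ) (hν : 0 < ν)
    (A₁ A₂ α₁ α₂ : ℝ) (hA₁ : 0 < A₁) (hA₂ : 0 < A₂) (hα₁ : 0 < α₁) (hα₂ : 0 < α₂) :
    (Summable fun n : ℕ => sphMult d n *
        ((maternSphSpec A₂ α₂ ν d n - maternSphSpec A₁ α₁ ν d n) /
          maternSphSpec A₁ α₁ ν d n) ^ 2) ↔ A₁ = A₂ := by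
  have hd1 : 1 ≤ d := by omega
  have hc₁ : 0 < 2 * ν * α₁ ^ 2 := by positivity
  have hq := tendsto_base_quotient hd1 hc₁ (2 * ν * α₂ ^ 2)
  have hderiv := Real.hasDerivAt_rpow_const (x := 1) (p := -(ν + (d : ℝ) / 2))
    (Or.inl one_ne_zero)
  simp only [maternSphSpec_sub_div hd1 hν A₂ hA₁ hα₁ hα₂]
  constructor
  · intro h
    have hlim := (((hderiv.continuousAt.tendsto.comp hq).const_mul (A₂ / A₁)).sub_const 1).pow 2
    have hzero := squeeze_zero (fun n => sq_nonneg _)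
      (fun n => le_mul_of_one_le_left (sq_nonneg _) (sphMult_bounds hd n).1)
      h.tendsto_atTop_zero
    have heq := tendsto_nhds_unique hlim hzero
    rw [Real.one_rpow, mul_one, sq_eq_zero_iff, sub_eq_zero, div_eq_one_iff_eq hA₁.ne'] at heq
    exact heq.symm
  · rintro rfl
    simp only [div_self hA₁.ne', one_mul]
    have hO := (hderiv.differentiableAt.isBigO_sub.comp_tendsto hq).trans
      (base_quotient_sub_one_isBigO hd1 hc₁ (2 * ν * α₂ ^ 2))
    simp only [Function.comp_def, Real.one_rpow] at hO
    refine summable_of_isBigO_nat (Real.summable_nat_pow_inv.2 one_lt_two)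
      (((sphMult_isBigO hd).mul (hO.pow 2)).congr' EventuallyEq.rfl ?_)
    filter_upwards [eventually_ge_atTop 1] with n hn
    have hn' : (n : ℝ) ≠ 0 := by positivity
    field_simp
end

section
/- For i = 1, 2 let σ_i > 0 and α_i > 0, and define ρ_i : ℤ → ℝ by ρ_i(n) = 2σ_i²α_i·tanh(α_i/2)·(α_i² + 4π²n²)^{−1}. Then the series Σ_{n ∈ ℤ} ((ρ₂(n) − ρ₁(n))/ρ₁(n))² converges if and only if σ₁²α₁·tanh(α₁/2) = σ₂²α₂·tanh(α₂/2). -/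
open Real

/-- The spectral density on `ℤ` of the Matérn covariogram on the circle `S¹` with
smoothness `ν = 1/2`, variance `σ²` and decay `α`:
`ρ(n) = 2σ²α·tanh(α/2)·(α² + 4π²n²)⁻¹`. -/
noncomputable def circleSpecHalf (σ α : ℝ) (n : ℤ) : ℝ :=
  2 * σ ^ 2 * α * Real.tanh (α / 2) * (α ^ 2 + 4 * π ^ 2 * (n : ℝ) ^ 2)⁻¹

/-- The microergodic parameter is positive whenever `σ` and `α` are. -/
lemma sq_mul_mul_tanh_half_pos {σ α : ℝ} (hσ : 0 < σ) (hα : 0 < α) :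
    0 < σ ^ 2 * α * Real.tanh (α / 2) := by
  have : 0 < Real.tanh (α / 2) := by
    rw [Real.tanh_eq_sinh_div_cosh]
    exact div_pos (Real.sinh_pos_iff.2 (by positivity)) (Real.cosh_pos _)
  positivity

lemma summable_inv_sq_add_four_mul_pi_sq_mul_sq (α : ℝ) :
    Summable fun n : ℤ => (α ^ 2 + 4 * π ^ 2 * (n : ℝ) ^ 2)⁻¹ := by
  refine .of_norm_bounded_eventually (Real.summable_one_div_int_pow.2 one_lt_two) ?_
  filter_upwards [(Set.finite_singleton (0 : ℤ)).compl_mem_cofinite] with n hn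
  have hn : (n : ℝ) ≠ 0 := Int.cast_ne_zero.2 (by simpa using hn)
  have hn2 : 0 < (n : ℝ) ^ 2 := by positivity
  rw [Real.norm_of_nonneg (by positivity), ← one_div]
  refine one_div_le_one_div_of_le hn2 ?_
  nlinarith [sq_nonneg α, show 1 ≤ 4 * π ^ 2 by nlinarith [Real.pi_gt_three]]

/-- The relative difference of two spectral densities is a constant plus a summable term. -/
lemma circleSpecHalf_sub_div {σ₁ σ₂ α₁ α₂ : ℝ} (hσ₁ : 0 < σ₁) (hα₁ : 0 < α₁) (hα₂ : 0 < α₂)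
    (n : ℤ) :
    (circleSpecHalf σ₂ α₂ n - circleSpecHalf σ₁ α₁ n) / circleSpecHalf σ₁ α₁ n =
      ((σ₂ ^ 2 * α₂ * Real.tanh (α₂ / 2)) / (σ₁ ^ 2 * α₁ * Real.tanh (α₁ / 2)) - 1) +
        (σ₂ ^ 2 * α₂ * Real.tanh (α₂ / 2)) / (σ₁ ^ 2 * α₁ * Real.tanh (α₁ / 2)) *
          (α₁ ^ 2 - α₂ ^ 2) * (α₂ ^ 2 + 4 * π ^ 2 * (n : ℝ) ^ 2)⁻¹ := by
  have hc := (sq_mul_mul_tanh_half_pos hσ₁ hα₁).ne'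
  have h₁ : α₁ ^ 2 + 4 * π ^ 2 * (n : ℝ) ^ 2 ≠ 0 := by positivity
  have h₂ : α₂ ^ 2 + 4 * π ^ 2 * (n : ℝ) ^ 2 ≠ 0 := by positivity
  have ht : Real.tanh (α₁ / 2) ≠ 0 := right_ne_zero_of_mul hc
  simp only [circleSpecHalf]
  field_simp
  ring

/-- For `i = 1,2` let `σ_i > 0` and `α_i > 0`, and define `ρ_i : ℤ → ℝ` by
`ρ_i(n) = 2σ_i²α_i·tanh(α_i/2)·(α_i² + 4π²n²)⁻¹`. Then the series
`Σ_{n ∈ ℤ} ((ρ₂(n) − ρ₁(n))/ρ₁(n))²` converges if and only if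
`σ₁²α₁·tanh(α₁/2) = σ₂²α₂·tanh(α₂/2)`. -/
theorem stmt_13 (σ₁ σ₂ α₁ α₂ : ℝ) (hσ₁ : 0 < σ₁) (hσ₂ : 0 < σ₂)
    (hα₁ : 0 < α₁) (hα₂ : 0 < α₂) :
    (Summable fun n : ℤ =>
        ((circleSpecHalf σ₂ α₂ n - circleSpecHalf σ₁ α₁ n) / circleSpecHalf σ₁ α₁ n) ^ 2) ↔
      σ₁ ^ 2 * α₁ * Real.tanh (α₁ / 2) = σ₂ ^ 2 * α₂ * Real.tanh (α₂ / 2) := by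
  simp_rw [circleSpecHalf_sub_div hσ₁ hα₁ hα₂]
  have hc := (sq_mul_mul_tanh_half_pos hσ₁ hα₁).ne'
  have hD := summable_inv_sq_add_four_mul_pi_sq_mul_sq α₂
  constructor
  · intro h
    have hlim := ((hD.tendsto_cofinite_zero.const_mul
      ((σ₂ ^ 2 * α₂ * Real.tanh (α₂ / 2)) / (σ₁ ^ 2 * α₁ * Real.tanh (α₁ / 2)) *
        (α₁ ^ 2 - α₂ ^ 2))).const_add
      ((σ₂ ^ 2 * α₂ * Real.tanh (α₂ / 2)) / (σ₁ ^ 2 * α₁ * Real.tanh (α₁ / 2)) - 1)).pow 2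
    have h0 := tendsto_nhds_unique hlim h.tendsto_cofinite_zero
    rw [mul_zero, add_zero, sq_eq_zero_iff, sub_eq_zero, div_eq_one_iff_eq hc] at h0
    exact h0.symm
  · intro h
    simp_rw [← h, div_self hc, sub_self, zero_add, one_mul, mul_pow]
    refine Summable.mul_left _ (.of_nonneg_of_le (fun n => sq_nonneg _) (fun n => ?_)
      (hD.mul_left (α₂ ^ 2)⁻¹))
    rw [sq]
    gcongr
    exact le_add_of_nonneg_right (by positivity)
end

section
/- Let ν > 0 and for i = 1, 2 let A_i > 0 and α_i > 0, and define ρ_i : ℤ → ℝ by ρ_i(n) = A_i·(α_i² + 4π²n²)^{−ν−1/2}. Then the series Σ_{n ∈ ℤ} ((ρ₂(n) − ρ₁(n))/ρ₁(n))² converges if and only if A₁ = A₂. -/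
open Real

/-- The spectral density on `ℤ` of the Matérn covariogram on the circle `S¹` with
smoothness `ν` and constant prefactor `A`: `ρ(n) = A·(α² + 4π²n²)^{−ν−1/2}`. -/
noncomputable def circleSpec (A α ν : ℝ) (n : ℤ) : ℝ :=
  A * (α ^ 2 + 4 * π ^ 2 * (n : ℝ) ^ 2) ^ (-(ν + 1 / 2))

open Filter Topology Asymptotics

lemma circleSpec_base_pos {α : ℝ} (hα : 0 < α) (n : ℤ) :
    0 < α ^ 2 + 4 * π ^ 2 * (n : ℝ) ^ 2 := by positivity

lemma inv_circleSpec_base_isBigO {α : ℝ} (hα : 0 < α) :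
    (fun n : ℤ => (α ^ 2 + 4 * π ^ 2 * (n : ℝ) ^ 2)⁻¹) =O[cofinite]
      fun n : ℤ => 1 / (n : ℝ) ^ 2 := by
  refine IsBigO.of_bound 1 ?_
  filter_upwards [(Set.finite_singleton (0 : ℤ)).compl_mem_cofinite] with n hn
  have hn0 : (n : ℝ) ≠ 0 := Int.cast_ne_zero.mpr hn
  have hn2 : 0 < (n : ℝ) ^ 2 := by positivity
  rw [Real.norm_of_nonneg (by positivity), Real.norm_of_nonneg (by positivity), one_mul, one_div]
  refine inv_anti₀ hn2 ?_
  have hπ : 1 ≤ 4 * π ^ 2 := by nlinarith [pi_gt_three]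
  nlinarith [mul_le_mul_of_nonneg_right hπ hn2.le, sq_nonneg α]

lemma tendsto_inv_circleSpec_base {α : ℝ} (hα : 0 < α) :
    Tendsto (fun n : ℤ => (α ^ 2 + 4 * π ^ 2 * (n : ℝ) ^ 2)⁻¹) cofinite (𝓝 0) :=
  (summable_of_isBigO (Real.summable_one_div_int_pow.mpr one_lt_two)
    (inv_circleSpec_base_isBigO hα)).tendsto_cofinite_zero

lemma circleSpec_sub_div {A₁ A₂ α₁ α₂ : ℝ} (ν : ℝ) (hA₁ : 0 < A₁)
    (hα₁ : 0 < α₁) (hα₂ : 0 < α₂) (n : ℤ) :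
    (circleSpec A₂ α₂ ν n - circleSpec A₁ α₁ ν n) / circleSpec A₁ α₁ ν n =
      A₂ / A₁ * (1 + (α₁ ^ 2 - α₂ ^ 2) * (α₂ ^ 2 + 4 * π ^ 2 * (n : ℝ) ^ 2)⁻¹) ^ (ν + 1 / 2)
        - 1 := by
  have h₁ := circleSpec_base_pos hα₁ n
  have h₂ := circleSpec_base_pos hα₂ n
  have hbase : 1 + (α₁ ^ 2 - α₂ ^ 2) * (α₂ ^ 2 + 4 * π ^ 2 * (n : ℝ) ^ 2)⁻¹ =
      (α₁ ^ 2 + 4 * π ^ 2 * (n : ℝ) ^ 2) / (α₂ ^ 2 + 4 * π ^ 2 * (n : ℝ) ^ 2) := by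
    field_simp
    ring
  rw [hbase, div_rpow h₁.le h₂.le, circleSpec, circleSpec, rpow_neg h₁.le, rpow_neg h₂.le]
  have h₁' := rpow_pos_of_pos h₁ (ν + 1 / 2)
  have h₂' := rpow_pos_of_pos h₂ (ν + 1 / 2)
  generalize (α₁ ^ 2 + 4 * π ^ 2 * (n : ℝ) ^ 2) ^ (ν + 1 / 2) = x at *
  generalize (α₂ ^ 2 + 4 * π ^ 2 * (n : ℝ) ^ 2) ^ (ν + 1 / 2) = y at *
  field_simp

lemma differentiableAt_one_add_mul_rpow (d p : ℝ) :
    DifferentiableAt ℝ (fun x : ℝ => (1 + d * x) ^ p) 0 :=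
  DifferentiableAt.rpow_const (by fun_prop) (Or.inl (by simp))

/-- Let `ν > 0` and for `i = 1,2` let `A_i > 0` and `α_i > 0`, and define
`ρ_i : ℤ → ℝ` by `ρ_i(n) = A_i·(α_i² + 4π²n²)^{−ν−1/2}`. Then the series
`Σ_{n ∈ ℤ} ((ρ₂(n) − ρ₁(n))/ρ₁(n))²` converges if and only if `A₁ = A₂`. -/
theorem stmt_14 (ν : ℝ) (hν : 0 < ν) (A₁ A₂ α₁ α₂ : ℝ)
    (hA₁ : 0 < A₁) (hA₂ : 0 < A₂) (hα₁ : 0 < α₁) (hα₂ : 0 < α₂) :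
    (Summable fun n : ℤ =>
        ((circleSpec A₂ α₂ ν n - circleSpec A₁ α₁ ν n) / circleSpec A₁ α₁ ν n) ^ 2) ↔
      A₁ = A₂ := by
  simp_rw [circleSpec_sub_div ν hA₁ hα₁ hα₂]
  have hdiff := differentiableAt_one_add_mul_rpow (α₁ ^ 2 - α₂ ^ 2) (ν + 1 / 2)
  have he := tendsto_inv_circleSpec_base hα₂
  constructor
  · intro hs
    have hlim := (((hdiff.continuousAt.tendsto.comp he).const_mul (A₂ / A₁)).sub_const 1).pow 2
    have h0 := tendsto_nhds_unique hlim hs.tendsto_cofinite_zero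
    simp only [mul_zero, add_zero, one_rpow, mul_one] at h0
    have h1 : A₂ / A₁ = 1 := sub_eq_zero.mp (pow_eq_zero_iff two_ne_zero |>.mp h0)
    exact ((div_eq_one_iff_eq hA₁.ne').mp h1).symm
  · rintro rfl
    have hO := hdiff.isBigO_sub.comp_tendsto he
    simp only [Function.comp_def, sub_zero, mul_zero, add_zero, one_rpow] at hO
    have hO := (hO.trans (inv_circleSpec_base_isBigO hα₂)).pow 2
    refine summable_of_isBigO (Real.summable_one_div_int_pow.mpr (by norm_num : 1 < 4)) ?_
    refine hO.congr (fun n => ?_) (fun n => ?_)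
    · simp [div_self hA₁.ne']
    · ring
end

section
/- Let ν > 0 and for i = 1, 2 let A_i > 0 and α_i > 0, and define ρ_i : ℕ → ℝ by ρ_i(n) = A_i·(2να_i² + n(n+1))^{−ν−1}. Then the series Σ_{n=0}^{∞} (2n + 1)·((ρ₂(n) − ρ₁(n))/ρ₁(n))² converges if and only if A₁ = A₂. -/
/-- The spectral density of the Matérn covariogram on the sphere `S²` with smoothness `ν`
and constant prefactor `A`: `ρ(n) = A·(2να² + n(n+1))^{−ν−1}`. -/
noncomputable def sphereSpec (A α ν : ℝ) (n : ℕ) : ℝ :=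
  A * (2 * ν * α ^ 2 + (n : ℝ) * ((n : ℝ) + 1)) ^ (-(ν + 1))

open Filter Topology Asymptotics

lemma sphereSpec_sub_div {A₁ A₂ α₁ α₂ ν : ℝ} (hν : 0 < ν) (hA₁ : 0 < A₁)
    (hα₁ : 0 < α₁) (hα₂ : 0 < α₂) (n : ℕ) :
    (sphereSpec A₂ α₂ ν n - sphereSpec A₁ α₁ ν n) / sphereSpec A₁ α₁ ν n =
      A₂ / A₁ * ((2 * ν * α₁ ^ 2 + (n : ℝ) * ((n : ℝ) + 1)) /
        (2 * ν * α₂ ^ 2 + (n : ℝ) * ((n : ℝ) + 1))) ^ (ν + 1) - 1 := by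
  have h₁ : 0 < 2 * ν * α₁ ^ 2 + (n : ℝ) * ((n : ℝ) + 1) := by positivity
  have h₂ : 0 < 2 * ν * α₂ ^ 2 + (n : ℝ) * ((n : ℝ) + 1) := by positivity
  have hp₁ := Real.rpow_pos_of_pos h₁ (ν + 1)
  have hp₂ := Real.rpow_pos_of_pos h₂ (ν + 1)
  unfold sphereSpec
  rw [Real.rpow_neg h₁.le, Real.rpow_neg h₂.le, Real.div_rpow h₁.le h₂.le]
  field_simp

lemma shifted_ratio_sub_one_isBigO {a b : ℝ} (hb : 0 < b) :
    (fun n : ℕ => (a + (n : ℝ) * ((n : ℝ) + 1)) / (b + (n : ℝ) * ((n : ℝ) + 1)) - 1)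
      =O[atTop] fun n : ℕ => ((n : ℝ) ^ 2)⁻¹ := by
  refine IsBigO.of_bound |a - b| ?_
  filter_upwards [eventually_ge_atTop 1] with n hn
  have hn' : (0 : ℝ) < n := by exact_mod_cast hn
  have hd : 0 < b + (n : ℝ) * ((n : ℝ) + 1) := by positivity
  have he : (a + (n : ℝ) * ((n : ℝ) + 1)) / (b + (n : ℝ) * ((n : ℝ) + 1)) - 1 =
      (a - b) * (b + (n : ℝ) * ((n : ℝ) + 1))⁻¹ := by
    field_simp
    ring
  rw [he, norm_mul, Real.norm_eq_abs, Real.norm_of_nonneg (by positivity),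
    Real.norm_of_nonneg (by positivity)]
  gcongr
  nlinarith

lemma tendsto_shifted_ratio {a b : ℝ} (hb : 0 < b) :
    Tendsto (fun n : ℕ => (a + (n : ℝ) * ((n : ℝ) + 1)) / (b + (n : ℝ) * ((n : ℝ) + 1)))
      atTop (𝓝 1) :=
  tendsto_sub_nhds_zero_iff.mp
    ((shifted_ratio_sub_one_isBigO hb).trans_tendsto tendsto_inv_natCast_sq)

lemma shifted_ratio_rpow_sub_one_isBigO {a b : ℝ} (hb : 0 < b) (p : ℝ) :
    (fun n : ℕ =>
      ((a + (n : ℝ) * ((n : ℝ) + 1)) / (b + (n : ℝ) * ((n : ℝ) + 1))) ^ p - 1)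
      =O[atTop] fun n : ℕ => ((n : ℝ) ^ 2)⁻¹ := by
  have h := (Real.hasDerivAt_rpow_const (x := 1) (p := p) (Or.inl one_ne_zero)).isBigO_sub
  simp only [Real.one_rpow] at h
  exact (h.comp_tendsto (tendsto_shifted_ratio hb)).trans (shifted_ratio_sub_one_isBigO hb)

lemma summable_mul_sq_of_isBigO {r : ℕ → ℝ} (hr : r =O[atTop] fun n : ℕ => ((n : ℝ) ^ 2)⁻¹) :
    Summable fun n : ℕ => (2 * (n : ℝ) + 1) * r n ^ 2 := by
  have hlin : (fun n : ℕ => 2 * (n : ℝ) + 1) =O[atTop] fun n : ℕ => (n : ℝ) := by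
    refine IsBigO.of_bound 3 ?_
    filter_upwards [eventually_ge_atTop 1] with n hn
    have hn' : (1 : ℝ) ≤ n := by exact_mod_cast hn
    rw [Real.norm_of_nonneg (by positivity), Real.norm_of_nonneg (by positivity)]
    linarith
  refine summable_of_isBigO_nat (Real.summable_nat_pow_inv.mpr (by norm_num : 1 < 3))
    ((hlin.mul (hr.pow 2)).congr_right fun n => ?_)
  rcases eq_or_ne (n : ℝ) 0 with h | h
  · simp [h]
  · field_simp

lemma tendsto_zero_of_summable_mul_sq_s15 {r : ℕ → ℝ}
    (h : Summable fun n : ℕ => (2 * (n : ℝ) + 1) * r n ^ 2) : Tendsto r atTop (𝓝 0) := by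
  have hsq : Tendsto (fun n => r n ^ 2) atTop (𝓝 0) :=
    squeeze_zero (fun n => sq_nonneg _)
      (fun n => le_mul_of_one_le_left (sq_nonneg _) (by linarith [n.cast_nonneg (α := ℝ)]))
      h.tendsto_atTop_zero
  rw [tendsto_zero_iff_abs_tendsto_zero]
  simpa [Real.sqrt_sq_eq_abs, Function.comp_def] using hsq.sqrt

/-- Let `ν > 0` and for `i = 1,2` let `A_i > 0` and `α_i > 0`, and define
`ρ_i : ℕ → ℝ` by `ρ_i(n) = A_i·(2να_i² + n(n+1))^{−ν−1}`. Then the series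
`Σ_{n=0}^∞ (2n + 1)·((ρ₂(n) − ρ₁(n))/ρ₁(n))²` converges if and only if `A₁ = A₂`. -/
theorem stmt_15 (ν : ℝ) (hν : 0 < ν) (A₁ A₂ α₁ α₂ : ℝ)
    (hA₁ : 0 < A₁) (hA₂ : 0 < A₂) (hα₁ : 0 < α₁) (hα₂ : 0 < α₂) :
    (Summable fun n : ℕ => (2 * (n : ℝ) + 1) *
        ((sphereSpec A₂ α₂ ν n - sphereSpec A₁ α₁ ν n) / sphereSpec A₁ α₁ ν n) ^ 2) ↔
      A₁ = A₂ := by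
  have hb : 0 < 2 * ν * α₂ ^ 2 := by positivity
  simp only [sphereSpec_sub_div hν hA₁ hα₁ hα₂]
  constructor
  · intro h
    have hlim := (((tendsto_shifted_ratio (a := 2 * ν * α₁ ^ 2) hb).rpow_const
      (p := ν + 1) (Or.inl one_ne_zero)).const_mul (A₂ / A₁)).sub_const 1
    have heq := tendsto_nhds_unique (tendsto_zero_of_summable_mul_sq_s15 h) hlim
    rw [Real.one_rpow, mul_one] at heq
    exact ((div_eq_one_iff_eq hA₁.ne').mp (by linarith)).symm
  · rintro rfl
    simp only [div_self hA₁.ne', one_mul]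
    exact summable_mul_sq_of_isBigO (shifted_ratio_rpow_sub_one_isBigO hb _)
end

section
/- For all real ν > 0 and α > 0 and every integer N ≥ 1, Σ_{n=N+1}^{∞} (2n + 1)·(2να² + n(n+1))^{−ν−1} ≤ (3/(2ν))·N^{−2ν}. -/
/-- The general term `(2n + 1)·(2να² + n(n+1))^{−ν−1}` of the spectral series of the
Matérn covariogram on the sphere `S²`. -/
noncomputable def sphereTerm (ν α : ℝ) (n : ℕ) : ℝ :=
  (2 * (n : ℝ) + 1) * (2 * ν * α ^ 2 + (n : ℝ) * ((n : ℝ) + 1)) ^ (-(ν + 1))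

/-- Tangent-line bound at `x + 1` for the convex function `x ↦ x ^ (-s)`. -/
theorem mul_rpow_le_rpow_sub_rpow {s x : ℝ} (hs : 0 < s) (hx : 0 < x) :
    s * (x + 1) ^ (-s - 1) ≤ x ^ (-s) - (x + 1) ^ (-s) := by
  have hx1 : 0 < x + 1 := by linarith
  have hq : 0 < x / (x + 1) := div_pos hx hx1
  have hratio : 1 + s / (x + 1) ≤ (x / (x + 1)) ^ (-s) := by
    rw [Real.rpow_def_of_pos hq]
    have hexp := Real.add_one_le_exp (Real.log (x / (x + 1)) * -s)
    have hlog := mul_le_mul_of_nonneg_left (Real.log_le_sub_one_of_pos hq) hs.le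
    have hsub : s * (x / (x + 1) - 1) = -(s / (x + 1)) := by field_simp; ring
    linarith
  rw [Real.div_rpow hx.le hx1.le, le_div_iff₀ (Real.rpow_pos_of_pos hx1 _)] at hratio
  have hpow : s * (x + 1) ^ (-s - 1) = s / (x + 1) * (x + 1) ^ (-s) := by
    rw [Real.rpow_sub_one hx1.ne']
    ring
  linarith

theorem sphereTerm_nonneg {ν : ℝ} (hν : 0 ≤ ν) (α : ℝ) (n : ℕ) : 0 ≤ sphereTerm ν α n := by
  unfold sphereTerm
  positivity

theorem sphereTerm_le {ν : ℝ} (hν : 0 < ν) (α : ℝ) {n : ℕ} (hn : 1 ≤ n) :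
    sphereTerm ν α n ≤ 3 * (n : ℝ) ^ (-(2 * ν) - 1) := by
  have hn1 : (1 : ℝ) ≤ n := by exact_mod_cast hn
  have hn0 : (0 : ℝ) < n := by linarith
  have hbase : (n : ℝ) ^ (2 : ℝ) ≤ 2 * ν * α ^ 2 + (n : ℝ) * ((n : ℝ) + 1) := by
    rw [Real.rpow_two]
    nlinarith [mul_nonneg hν.le (sq_nonneg α)]
  calc sphereTerm ν α n
      ≤ (3 * n) * ((n : ℝ) ^ (2 : ℝ)) ^ (-(ν + 1)) := by
        unfold sphereTerm
        exact mul_le_mul (by linarith)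
          (Real.rpow_le_rpow_of_nonpos (by positivity) hbase (by linarith))
          (by positivity) (by positivity)
    _ = 3 * (n : ℝ) ^ (-(2 * ν) - 1) := by
        rw [← Real.rpow_mul hn0.le, mul_assoc, ← Real.rpow_one_add' hn0.le (by linarith)]
        ring_nf

theorem sphereTerm_succ_le {ν : ℝ} (hν : 0 < ν) (α : ℝ) {m : ℕ} (hm : 1 ≤ m) :
    sphereTerm ν α (m + 1) ≤
      3 / (2 * ν) * ((m : ℝ) ^ (-(2 * ν)) - ((m + 1 : ℕ) : ℝ) ^ (-(2 * ν))) := by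
  have hm0 : (0 : ℝ) < m := by exact_mod_cast hm
  refine (sphereTerm_le hν α m.succ_pos).trans ?_
  have htangent := mul_le_mul_of_nonneg_left
    (mul_rpow_le_rpow_sub_rpow (s := 2 * ν) (by positivity) hm0)
    (show 0 ≤ 3 / (2 * ν) by positivity)
  rw [← mul_assoc, div_mul_cancel₀ _ (by positivity : 2 * ν ≠ 0)] at htangent
  exact_mod_cast htangent

/-- For all real `ν > 0` and `α > 0` and every integer `N ≥ 1`,
`Σ_{n=N+1}^∞ (2n + 1)·(2να² + n(n+1))^{−ν−1} ≤ (3/(2ν))·N^{−2ν}`. -/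
theorem stmt_16 (ν α : ℝ) (hν : 0 < ν) (hα : 0 < α) (N : ℕ) (hN : 1 ≤ N) :
    (∑' n : ℕ, sphereTerm ν α (n + N + 1)) ≤ 3 / (2 * ν) * (N : ℝ) ^ (-(2 * ν)) := by
  refine Real.tsum_le_of_sum_range_le (fun n => sphereTerm_nonneg hν.le α _) fun k => ?_
  let f : ℕ → ℝ := fun n => ((n + N : ℕ) : ℝ) ^ (-(2 * ν))
  calc ∑ n ∈ Finset.range k, sphereTerm ν α (n + N + 1)
      ≤ ∑ n ∈ Finset.range k, 3 / (2 * ν) * (f n - f (n + 1)) := by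
        refine Finset.sum_le_sum fun n _ => ?_
        have hstep := sphereTerm_succ_le hν α (m := n + N) (by omega)
        rwa [Nat.add_right_comm n N 1] at hstep ⊢
    _ = 3 / (2 * ν) * (f 0 - f k) := by
        rw [← Finset.mul_sum, Finset.sum_range_sub']
    _ ≤ 3 / (2 * ν) * (N : ℝ) ^ (-(2 * ν)) := by
        have hf : 0 ≤ f k := by positivity
        have hf0 : f 0 = (N : ℝ) ^ (-(2 * ν)) := by simp [f]
        gcongr
        linarith
end
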